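/- There is a constant k_0 ∈ ℕ such that for every k ≥ k_0 and every d with 2k·ln k − ln k − 4 ≤ d ≤ 2k·ln k, the following holds for all sufficiently large n and every near-balanced σ: V → {1,...,k}: in the random multigraph G'(σ), with probability at least 1 − exp(−16n/k) all three of the following hold: (1) |W| ≤ n·k^{−0.7}; (2) |W_i| ≤ n·ln ln k/(k·ln k) for all i ∈ {1,...,k}; and (3) there are at most (ln k)^4 indices i ∈ {1,...,k} with |W_i| ≥ n/(k·(ln k)^4). -/

import Mathlib

/-- Uniform counting probability on a finite sample space `Ω`. -/
noncomputable def prob {Ω : Type*} (p : Ω → Prop) : ℝ :=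
  (Nat.card {x : Ω // p x} : ℝ) / (Nat.card Ω : ℝ)

/-- The sample space of the random multigraph `G'(σ)`: `m` ordered pairs drawn
uniformly and independently from `{(u,v) : σ u ≠ σ v}`. -/
abbrev CondSpace (n m k : ℕ) (σ : Fin n → Fin k) : Type :=
  {e : Fin m → Fin n × Fin n // ∀ i : Fin m, σ (e i).1 ≠ σ (e i).2}

/-- `e(A,B)`: the number of edges (with multiplicity) with one endpoint in `A`
and the other in `B`. -/
noncomputable def eSet {n m : ℕ} (e : Fin m → Fin n × Fin n) (A B : Set (Fin n)) : ℕ :=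
  Nat.card {t : Fin m // ((e t).1 ∈ A ∧ (e t).2 ∈ B) ∨ ((e t).1 ∈ B ∧ (e t).2 ∈ A)}

/-- `σ` is near-balanced: every color class has size `n/k` up to `n/(k·(ln k)^{1/3})`. -/
def NearBalanced (n k : ℕ) (σ : Fin n → Fin k) : Prop :=
  ∀ i : Fin k,
    |(Nat.card {v : Fin n // σ v = i} : ℝ) - n / k| ≤ n / (k * Real.log k ^ ((1 : ℝ) / 3))

/-- `ℓ = e^{−7}·ln k`. -/
noncomputable def ell (k : ℕ) : ℝ := Real.exp (-7) * Real.log k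

/-- `W_i = {v ∈ V_i : ∃ j ≠ i, e(v,V_j) < 3ℓ}`. -/
def Wset {n m k : ℕ} (σ : Fin n → Fin k) (e : Fin m → Fin n × Fin n) (i : Fin k) :
    Set (Fin n) :=
  {v | σ v = i ∧ ∃ j : Fin k, j ≠ i ∧ (eSet e {v} {u | σ u = j} : ℝ) < 3 * ell k}

open Finset

section prob

variable {Ω : Type*}

theorem prob_mono [Finite Ω] {p q : Ω → Prop} (h : ∀ ω, p ω → q ω) : prob p ≤ prob q := by
  unfold prob
  gcongr
  exact Nat.card_le_card_of_injective (Subtype.map id h) (Subtype.map_injective h Function.injective_id)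

theorem prob_eq_sum_div [Fintype Ω] (p : Ω → Prop) [DecidablePred p] :
    prob p = (∑ ω, if p ω then (1 : ℝ) else 0) / Fintype.card Ω := by
  simp [prob, Nat.card_eq_fintype_card, Fintype.card_subtype]

theorem prob_le_sum [Finite Ω] {ι : Type*} (s : Finset ι) (q : ι → Ω → Prop) {p : Ω → Prop}
    (h : ∀ ω, p ω → ∃ i ∈ s, q i ω) : prob p ≤ ∑ i ∈ s, prob (q i) := by
  classical
  have := Fintype.ofFinite Ω
  simp only [prob_eq_sum_div]
  rw [← sum_div, sum_comm]
  gcongr with ω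
  split_ifs with hp
  · obtain ⟨i, hi, hq⟩ := h ω hp
    refine le_trans ?_ (single_le_sum (fun j _ => ?_) hi)
    · simp [hq]
    · split_ifs <;> norm_num
  · exact sum_nonneg fun j _ => by split_ifs <;> norm_num

theorem one_sub_prob_not_le [Finite Ω] [Nonempty Ω] (p : Ω → Prop) : 1 - prob (fun ω => ¬ p ω) ≤ prob p := by
  classical
  have := Fintype.ofFinite Ω
  have hc : (0 : ℝ) < Fintype.card Ω := by exact_mod_cast Fintype.card_pos
  simp only [prob_eq_sum_div]
  rw [sub_le_iff_le_add, ← add_div, ← sum_add_distrib, le_div_iff₀ hc, one_mul]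
  refine le_of_eq ?_
  rw [← nsmul_one, ← card_univ, ← sum_const]
  refine sum_congr rfl fun ω _ => ?_
  by_cases h : p ω <;> simp [h]

theorem prob_le_expectation_div [Fintype Ω] {p : Ω → Prop} {f : Ω → ℝ} (h0 : ∀ ω, 0 ≤ f ω)
    (h1 : ∀ ω, p ω → 1 ≤ f ω) : prob p ≤ (∑ ω, f ω) / Fintype.card Ω := by
  classical
  rw [prob_eq_sum_div]
  gcongr with ω
  split_ifs with hp
  exacts [h1 ω hp, h0 ω]

end prob

section CondSpace

variable {n m k : ℕ} {σ : Fin n → Fin k}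

theorem sum_condSpace_prod (g : Fin n × Fin n → ℝ) :
    ∑ e : CondSpace n m k σ, ∏ t, g (e.1 t) =
      (∑ p : {p : Fin n × Fin n // σ p.1 ≠ σ p.2}, g p) ^ m := by
  rw [Fintype.sum_pow]
  exact Fintype.sum_equiv (Equiv.subtypePiEquivPi (α := Fin m) (β := fun _ => Fin n × Fin n)
    (p := fun _ p => σ p.1 ≠ σ p.2)) _ _ fun e => rfl

theorem card_condSpace :
    (Fintype.card (CondSpace n m k σ) : ℝ) =
      (Fintype.card {p : Fin n × Fin n // σ p.1 ≠ σ p.2} : ℝ) ^ m := by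
  simpa using sum_condSpace_prod (m := m) (σ := σ) (fun _ => 1)

/-- Chernoff bound for the lower tail of the number of edges lying in `D`. -/
theorem prob_card_mem_le (hσ : ∃ p : Fin n × Fin n, σ p.1 ≠ σ p.2) (D : Finset (Fin n × Fin n))
    (hD : ∀ p ∈ D, σ p.1 ≠ σ p.2) (x : ℝ) {c : ℝ} (hc : 0 ≤ c) :
    prob (fun e : CondSpace n m k σ => (#{t | e.1 t ∈ D} : ℝ) ≤ x) ≤
      Real.exp (c * x - (1 - Real.exp (-c)) * #D * m / n ^ 2) := by
  classical
  set P := {p : Fin n × Fin n // σ p.1 ≠ σ p.2}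
  have : Nonempty P := by obtain ⟨p, hp⟩ := hσ; exact ⟨⟨p, hp⟩⟩
  set T : ℝ := (Fintype.card P : ℝ) with hT
  have hT0 : 0 < T := by rw [hT]; exact_mod_cast Fintype.card_pos
  have hTn : T ≤ (n : ℝ) ^ 2 := by
    have h := Fintype.card_subtype_le (fun p : Fin n × Fin n => σ p.1 ≠ σ p.2)
    rw [Fintype.card_prod, Fintype.card_fin] at h
    rw [hT, sq]; exact_mod_cast h
  have hDT : (#D : ℝ) ≤ T := by
    rw [hT, Fintype.card_subtype]
    exact_mod_cast card_le_card fun p hp => by simpa using hD p hp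
  set a : ℝ := 1 - Real.exp (-c) with ha
  have ha0 : 0 ≤ a := by rw [ha, sub_nonneg]; exact Real.exp_le_one_iff.2 (by linarith)
  have ha1 : a ≤ 1 := by rw [ha]; linarith [Real.exp_pos (-c)]
  have hsum : ∑ p : P, (if p.1 ∈ D then Real.exp (-c) else 1) = T - a * #D := by
    have h1 : ∀ p : P, (if p.1 ∈ D then Real.exp (-c) else 1) = 1 - a * if p.1 ∈ D then 1 else 0 := by
      intro p; split_ifs <;> simp [ha]
    rw [sum_congr rfl fun p _ => h1 p, sum_sub_distrib, ← mul_sum]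
    congr 1
    · simp [hT]
    · congr 1
      rw [sum_boole]
      congr 1
      refine card_bij (fun p _ => p.1) (by simp) (fun p _ q _ h => Subtype.ext h) ?_
      intro p hp
      exact ⟨⟨p, hD p hp⟩, by simpa using hp, rfl⟩
  have key := prob_le_expectation_div (Ω := CondSpace n m k σ)
    (p := fun e => (#{t | e.1 t ∈ D} : ℝ) ≤ x)
    (f := fun e => Real.exp (c * x) * ∏ t, (if e.1 t ∈ D then Real.exp (-c) else 1))
    (fun e => mul_nonneg (Real.exp_pos _).le
      (prod_nonneg fun t _ => by split_ifs <;> positivity)) (by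
      intro e he
      rw [prod_ite, prod_const, prod_const_one, mul_one, ← Real.exp_nat_mul, ← Real.exp_add]
      apply Real.one_le_exp
      nlinarith)
  refine key.trans ?_
  rw [← mul_sum, sum_condSpace_prod (m := m) (σ := σ)
    (fun p => if p ∈ D then Real.exp (-c) else 1), hsum, card_condSpace, ← hT, mul_div_assoc,
    ← div_pow, sub_eq_add_neg (c * x), Real.exp_add]
  gcongr
  have h1 : (T - a * #D) / T ≤ Real.exp (-(a * #D / n ^ 2)) := by
    calc (T - a * #D) / T = 1 - a * #D / T := by field_simp
      _ ≤ 1 - a * #D / n ^ 2 := by gcongr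
      _ ≤ _ := Real.one_sub_le_exp_neg _
  have h0 : 0 ≤ (T - a * #D) / T := by
    apply div_nonneg _ hT0.le
    nlinarith [(Nat.cast_nonneg #D : (0 : ℝ) ≤ #D)]
  calc ((T - a * #D) / T) ^ m ≤ Real.exp (-(a * #D / n ^ 2)) ^ m := by gcongr
    _ = _ := by rw [← Real.exp_nat_mul]; congr 1; ring

/-- Edges between a vertex `v ∈ S` and a vertex outside `S` of colour `j v`. -/
def crossPairs (σ : Fin n → Fin k) (S : Finset (Fin n)) (j : Fin n → Fin k) :
    Finset (Fin n × Fin n) :=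
  univ.filter fun p => (p.1 ∈ S ∧ p.2 ∉ S ∧ σ p.2 = j p.1) ∨ (p.2 ∈ S ∧ p.1 ∉ S ∧ σ p.1 = j p.2)

theorem le_card_crossPairs (S : Finset (Fin n)) (j : Fin n → Fin k) {q : ℝ}
    (hq : ∀ i, q ≤ #{u | σ u = i ∧ u ∉ S}) : 2 * (#S * q) ≤ #(crossPairs σ S j) := by
  classical
  set D₁ : Finset (Fin n × Fin n) := univ.filter fun p => p.1 ∈ S ∧ p.2 ∉ S ∧ σ p.2 = j p.1
  have h1 : #S * q ≤ #D₁ := by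
    rw [card_eq_sum_card_fiberwise (f := Prod.fst) (s := D₁) (t := S)
      (fun p hp => by simpa using (mem_filter.1 hp).2.1)]
    push_cast
    rw [← nsmul_eq_mul, ← sum_const]
    refine sum_le_sum fun v hv => (hq (j v)).trans ?_
    norm_cast
    refine card_le_card_of_injOn (fun u => (v, u)) ?_ (fun a _ b _ h => (Prod.ext_iff.1 h).2)
    intro u hu
    simp at hu
    simp [D₁, hv, hu]
  have h2 : crossPairs σ S j = D₁ ∪ D₁.image Prod.swap := by
    ext ⟨a, b⟩
    simp [crossPairs, D₁]
  have h3 : Disjoint D₁ (D₁.image Prod.swap) := by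
    rw [disjoint_left]
    rintro ⟨a, b⟩ h h'
    simp [D₁] at h h'
    exact h'.2.1 h.1
  rw [h2, card_union_of_disjoint h3, card_image_of_injective _ Prod.swap_injective]
  push_cast
  linarith

theorem card_mem_crossPairs_le (S : Finset (Fin n)) (j : Fin n → Fin k)
    (e : Fin m → Fin n × Fin n) :
    #{t | e t ∈ crossPairs σ S j} ≤ ∑ v ∈ S, eSet e {v} {u | σ u = j v} := by
  classical
  have h : ∀ v, eSet e {v} {u | σ u = j v} =
      #{t | ((e t).1 = v ∧ σ (e t).2 = j v) ∨ (σ (e t).1 = j v ∧ (e t).2 = v)} := by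
    intro v
    simp [eSet, Nat.card_eq_fintype_card, Fintype.card_subtype]
  simp only [h]
  refine le_trans (card_le_card ?_) card_biUnion_le
  intro t ht
  simp [crossPairs] at ht
  simp
  grind

theorem mem_Wset_iff {e : Fin m → Fin n × Fin n} {i : Fin k} {v : Fin n} :
    v ∈ Wset σ e i ↔ σ v = i ∧ v ∈ Wset σ e (σ v) := by
  constructor
  · rintro ⟨rfl, h⟩; exact ⟨rfl, rfl, h⟩
  · rintro ⟨rfl, h⟩; exact h

theorem prob_forall_few_le (hσ : ∃ p : Fin n × Fin n, σ p.1 ≠ σ p.2) (S : Finset (Fin n))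
    (j : Fin n → Fin k) (hj : ∀ v ∈ S, j v ≠ σ v) {q : ℝ}
    (hq : ∀ i, q ≤ #{u | σ u = i ∧ u ∉ S}) {y c : ℝ} (hc : 0 ≤ c) :
    prob (fun e : CondSpace n m k σ => ∀ v ∈ S, (eSet e.1 {v} {u | σ u = j v} : ℝ) < y) ≤
      Real.exp (#S * (c * y - (1 - Real.exp (-c)) * (2 * q) * m / n ^ 2)) := by
  have h := prob_card_mem_le (m := m) hσ (crossPairs σ S j) (by
    rintro ⟨a, b⟩ hp
    simp [crossPairs] at hp
    rcases hp with ⟨h1, -, h2⟩ | ⟨h1, -, h2⟩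
    · have := hj _ h1; simp only; rw [h2]; exact this.symm
    · have := hj _ h1; simp only; rw [h2]; exact this) (#S * y) hc
  refine le_trans (prob_mono fun e he => ?_) (h.trans ?_)
  · calc (#{t | e.1 t ∈ crossPairs σ S j} : ℝ) ≤ ∑ v ∈ S, (eSet e.1 {v} {u | σ u = j v} : ℝ) := by
          exact_mod_cast card_mem_crossPairs_le S j e.1
      _ ≤ ∑ v ∈ S, y := sum_le_sum fun v hv => (he v hv).le
      _ = _ := by simp
  · rw [Real.exp_le_exp]
    have ha : 0 ≤ 1 - Real.exp (-c) := by
      rw [sub_nonneg]; exact Real.exp_le_one_iff.2 (by linarith)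
    have h1 : (1 - Real.exp (-c)) * (2 * (#S * q)) * m / n ^ 2 ≤
        (1 - Real.exp (-c)) * #(crossPairs σ S j) * m / n ^ 2 := by
      gcongr
      exact le_card_crossPairs S j hq
    have h2 : #S * (c * y - (1 - Real.exp (-c)) * (2 * q) * m / n ^ 2) =
      c * (#S * y) - (1 - Real.exp (-c)) * (2 * (#S * q)) * m / n ^ 2 := by ring
    linarith

/-- Union bound over the witnesses `j`, for a fixed set `S` of exceptional vertices. -/
theorem prob_subset_W_le (hσ : ∃ p : Fin n × Fin n, σ p.1 ≠ σ p.2) (S : Finset (Fin n)) {q : ℝ}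
    (hq : ∀ i, q ≤ #{u | σ u = i ∧ u ∉ S}) {c : ℝ} (hc : 0 ≤ c) :
    prob (fun e : CondSpace n m k σ => ∀ v ∈ S, v ∈ Wset σ e.1 (σ v)) ≤
      (k * Real.exp (c * (3 * ell k) - (1 - Real.exp (-c)) * (2 * q) * m / n ^ 2)) ^ #S := by
  classical
  set b := c * (3 * ell k) - (1 - Real.exp (-c)) * (2 * q) * m / n ^ 2 with hb
  set F : Finset (Fin n → Fin k) :=
    Fintype.piFinset fun v => if v ∈ S then univ.erase (σ v) else {σ v}
  have hF : (#F : ℝ) ≤ (k : ℝ) ^ #S := by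
    have : #F ≤ k ^ #S := by
      rw [Fintype.card_piFinset]
      calc ∏ v, #(if v ∈ S then univ.erase (σ v) else {σ v})
          ≤ ∏ v, (if v ∈ S then k else 1) := prod_le_prod' fun v _ => by
            split_ifs
            · exact (card_le_univ _).trans (by simp)
            · simp
        _ = _ := by simp
    exact_mod_cast this
  calc _ ≤ ∑ j ∈ F, prob (fun e : CondSpace n m k σ =>
          ∀ v ∈ S, (eSet e.1 {v} {u | σ u = j v} : ℝ) < 3 * ell k) := by
        refine prob_le_sum F _ fun e he => ?_
        have h : ∀ v, ∃ i, (v ∈ S → i ≠ σ v ∧ (eSet e.1 {v} {u | σ u = i} : ℝ) < 3 * ell k) ∧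
            (v ∉ S → i = σ v) := by
          intro v
          by_cases hv : v ∈ S
          · obtain ⟨-, i, hi⟩ := he v hv
            exact ⟨i, fun _ => hi, fun h => absurd hv h⟩
          · exact ⟨σ v, fun h => absurd h hv, fun _ => rfl⟩
        choose j hj using h
        refine ⟨j, ?_, fun v hv => ((hj v).1 hv).2⟩
        rw [Fintype.mem_piFinset]
        intro v
        split_ifs with hv
        · simpa using ((hj v).1 hv).1
        · simpa using (hj v).2 hv
    _ ≤ ∑ j ∈ F, Real.exp (#S * b) := by
        refine sum_le_sum fun j hj => prob_forall_few_le hσ S j (fun v hv => ?_) hq hc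
        have := Fintype.mem_piFinset.1 hj v
        simp [hv] at this
        exact this
    _ = #F * Real.exp b ^ #S := by rw [sum_const, nsmul_eq_mul, Real.exp_nat_mul]
    _ ≤ _ := by rw [mul_pow]; gcongr

end CondSpace

theorem choose_le_exp_mul_div_pow (N s : ℕ) : (N.choose s : ℝ) ≤ (Real.exp 1 * N / s) ^ s := by
  rcases Nat.eq_zero_or_pos s with rfl | hs
  · simp
  have h1 : (s : ℝ) ^ s ≤ Real.exp 1 ^ s * s.factorial := by
    have := Real.pow_div_factorial_le_exp (s : ℝ) (Nat.cast_nonneg s) s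
    rwa [div_le_iff₀ (by positivity), ← mul_one (s : ℝ), Real.exp_nat_mul, mul_one] at this
  refine (Nat.choose_le_pow_div s N).trans ?_
  rw [div_pow, mul_pow, div_le_div_iff₀ (by positivity) (by positivity)]
  calc (N : ℝ) ^ s * s ^ s ≤ N ^ s * (Real.exp 1 ^ s * s.factorial) := by gcongr
    _ = _ := by ring

theorem prob_exists_subset_W_le {n m k : ℕ} {σ : Fin n → Fin k}
    (hσ : ∃ p : Fin n × Fin n, σ p.1 ≠ σ p.2) (U : Finset (Fin n)) (s : ℕ) {q δ : ℝ}
    (hq : ∀ i, q + δ ≤ #{u | σ u = i}) {c : ℝ} (hc : 0 ≤ c) :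
    prob (fun e : CondSpace n m k σ => ∃ S ⊆ U, #S = s ∧ (∀ i, (#{u ∈ S | σ u = i} : ℝ) ≤ δ) ∧
        ∀ v ∈ S, v ∈ Wset σ e.1 (σ v)) ≤
      (Real.exp 1 * #U / s *
        (k * Real.exp (c * (3 * ell k) - (1 - Real.exp (-c)) * (2 * q) * m / n ^ 2))) ^ s := by
  classical
  set b := k * Real.exp (c * (3 * ell k) - (1 - Real.exp (-c)) * (2 * q) * m / n ^ 2) with hb
  set F := (powersetCard s U).filter fun S => ∀ i, (#{u ∈ S | σ u = i} : ℝ) ≤ δ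
  calc _ ≤ ∑ S ∈ F, prob (fun e : CondSpace n m k σ => ∀ v ∈ S, v ∈ Wset σ e.1 (σ v)) := by
        refine prob_le_sum F _ ?_
        rintro e ⟨S, hSU, hs, hδ, hW⟩
        exact ⟨S, mem_filter.2 ⟨mem_powersetCard.2 ⟨hSU, hs⟩, hδ⟩, hW⟩
    _ ≤ ∑ S ∈ F, b ^ s := by
        refine sum_le_sum fun S hS => ?_
        obtain ⟨hS, hδ⟩ := mem_filter.1 hS
        have h := prob_subset_W_le (m := m) hσ S (q := q) (fun i => ?_) hc
        · rwa [(mem_powersetCard.1 hS).2] at h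
        · have h1 : #{u | σ u = i} ≤ #{u | σ u = i ∧ u ∉ S} + #{u ∈ S | σ u = i} := by
            refine (card_le_card fun u hu => ?_).trans (card_union_le _ _)
            simp at hu ⊢
            tauto
          have h2 : (#{u | σ u = i} : ℝ) ≤ #{u | σ u = i ∧ u ∉ S} + #{u ∈ S | σ u = i} := by
            exact_mod_cast h1
          linarith [hq i, hδ i]
    _ = #F * b ^ s := by rw [sum_const, nsmul_eq_mul]
    _ ≤ (#U).choose s * b ^ s := by
        have : #F ≤ (#U).choose s := by
          rw [← card_powersetCard]
          exact card_le_card (filter_subset _ _)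
        gcongr
    _ ≤ _ := by
        rw [mul_pow _ b]
        gcongr
        exact choose_le_exp_mul_div_pow _ _

/-- The lower bounds on `k` under which the estimates below are valid. -/
structure IsLarge (k : ℕ) : Prop where
  log_rpow : 100 ≤ Real.log k ^ ((1 : ℝ) / 3)
  log_log : 340 ≤ Real.log (Real.log k)
  log_log_le : 200 * Real.log (Real.log k) ≤ Real.log k
  log_pow : 2 * Real.exp 1 * (Real.log k ^ 4 + 1) ≤ Real.exp (0.75 * Real.log k)

theorem eventually_isLarge : ∀ᶠ k : ℕ in Filter.atTop, IsLarge k := by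
  have hlog : Filter.Tendsto (fun k : ℕ => Real.log k) Filter.atTop Filter.atTop :=
    Real.tendsto_log_atTop.comp tendsto_natCast_atTop_atTop
  have h1 := ((tendsto_rpow_atTop (y := (1 : ℝ) / 3) (by norm_num)).comp hlog).eventually_ge_atTop
    100
  have h2 := (Real.tendsto_log_atTop.comp hlog).eventually_ge_atTop 340
  have h3 := hlog.eventually (Real.isLittleO_log_id_atTop.bound (c := 1 / 200) (by norm_num))
  have h4 : ∀ᶠ x : ℝ in Filter.atTop,
      2 * Real.exp 1 * (x ^ 4 + 1) ≤ Real.exp (0.75 * x) := by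
    have h := (isLittleO_pow_exp_pos_mul_atTop 4 (b := (0.75 : ℝ)) (by norm_num)).bound
      (c := 1 / (4 * Real.exp 1)) (by positivity)
    filter_upwards [h, Filter.eventually_ge_atTop 1] with x hx hx1
    rw [Real.norm_of_nonneg (by positivity), Real.norm_of_nonneg (by positivity),
      div_mul_eq_mul_div, le_div_iff₀ (by positivity)] at hx
    have : 1 ≤ x ^ 4 := one_le_pow₀ hx1
    nlinarith [Real.exp_pos 1]
  filter_upwards [h1, h2, h3, hlog.eventually h4, hlog.eventually_ge_atTop 1] with k a b c d e
  refine ⟨a, b, ?_, d⟩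
  simp only [Function.comp_apply, id_eq] at b c
  rw [Real.norm_of_nonneg (by linarith), Real.norm_of_nonneg (by linarith)] at c
  linarith

namespace IsLarge

variable {k : ℕ}

theorem log_ge (h : IsLarge k) : 68000 ≤ Real.log k := by
  linarith [h.log_log, h.log_log_le]

theorem cast_ge (h : IsLarge k) : (68000 : ℝ) ≤ k :=
  h.log_ge.trans (Real.log_le_self (Nat.cast_nonneg k))

theorem exponent_le (hk : IsLarge k) {d : ℝ} {n m : ℕ} (hn : 0 < n)
    (hd : 2 * k * Real.log k - Real.log k - 4 ≤ d) (hm : d * n / 2 ≤ m) :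
    3 * (3 * ell k) - (1 - Real.exp (-3)) * (2 * (0.98 * (n / k))) * m / n ^ 2 ≤
      -1.8 * Real.log k := by
  have hL := hk.log_ge
  have hK := hk.cast_ge
  have hn' : (0 : ℝ) < n := by exact_mod_cast hn
  have he : (2.7 : ℝ) ≤ Real.exp 1 := by linarith [Real.exp_one_gt_d9]
  have e3 : Real.exp (-3) ≤ 0.06 := by
    rw [Real.exp_neg, inv_le_comm₀ (Real.exp_pos _) (by norm_num),
      show (3 : ℝ) = (3 : ℕ) * 1 by norm_num, Real.exp_nat_mul]
    exact le_trans (by norm_num) (pow_le_pow_left₀ (by norm_num) he 3)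
  have e7 : Real.exp (-7) ≤ 0.001 := by
    rw [Real.exp_neg, inv_le_comm₀ (Real.exp_pos _) (by norm_num),
      show (7 : ℝ) = (7 : ℕ) * 1 by norm_num, Real.exp_nat_mul]
    exact le_trans (by norm_num) (pow_le_pow_left₀ (by norm_num) he 7)
  have h1 : 0.99 * Real.log k ≤ n / k * m / n ^ 2 := by
    rw [le_div_iff₀ (by positivity), div_mul_eq_mul_div, le_div_iff₀ (by positivity)]
    have h2 : 0.99 * Real.log k * k ≤ d / 2 := by nlinarith
    calc 0.99 * Real.log k * n ^ 2 * k = 0.99 * Real.log k * k * n ^ 2 := by ring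
      _ ≤ d / 2 * n ^ 2 := by gcongr
      _ = n * (d * n / 2) := by ring
      _ ≤ n * m := by gcongr
  have h3 : (1 - Real.exp (-3)) * (2 * (0.98 * (n / k))) * m / n ^ 2 =
      (1 - Real.exp (-3)) * 1.96 * (n / k * m / n ^ 2) := by ring
  have h4 : 0.94 * 1.96 * (0.99 * Real.log k) ≤
      (1 - Real.exp (-3)) * 1.96 * (n / k * m / n ^ 2) := by
    have : 0.94 ≤ 1 - Real.exp (-3) := by linarith
    gcongr
  rw [h3, ell]
  nlinarith

theorem card_class_bounds (hk : IsLarge k) {n : ℕ} {σ : Fin n → Fin k} (hσ : NearBalanced n k σ)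
    (i : Fin k) :
    0.99 * (n / k : ℝ) ≤ #{u | σ u = i} ∧ (#{u | σ u = i} : ℝ) ≤ 2 * (n / k) := by
  have h := hσ i
  have hK := hk.cast_ge
  have h1 : (n : ℝ) / (k * Real.log k ^ ((1 : ℝ) / 3)) ≤ 0.01 * (n / k) := by
    calc (n : ℝ) / (k * Real.log k ^ ((1 : ℝ) / 3)) ≤ n / (k * 100) := by
          gcongr; exact hk.log_rpow
      _ = _ := by field_simp; ring
  rw [Nat.card_eq_fintype_card, Fintype.card_subtype] at h
  have h2 := abs_le.1 (h.trans h1)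
  have : (0 : ℝ) ≤ n / k := by positivity
  constructor <;> linarith [h2.1, h2.2]

theorem prob_exists_subset_W_le_exp (hk : IsLarge k) {d : ℝ} {n : ℕ} (hn : 0 < n)
    (hd : 2 * k * Real.log k - Real.log k - 4 ≤ d) {σ : Fin n → Fin k} (hσ : NearBalanced n k σ)
    (hσ' : ∃ p : Fin n × Fin n, σ p.1 ≠ σ p.2) (U : Finset (Fin n)) (s : ℕ)
    (hU : Real.exp 1 * #U ≤ s * Real.exp (0.75 * Real.log k))
    (hs : 340 * (n / k : ℝ) ≤ s * Real.log k) :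
    prob (fun e : CondSpace n ⌈d * n / 2⌉₊ k σ => ∃ S ⊆ U, #S = s ∧
        (∀ i, (#{u ∈ S | σ u = i} : ℝ) ≤ 0.01 * (n / k)) ∧ ∀ v ∈ S, v ∈ Wset σ e.1 (σ v)) ≤
      Real.exp (-17 * (n / k)) := by
  have hK := hk.cast_ge
  have hs0 : (0 : ℝ) < s := by
    have hn' : (0 : ℝ) < n := by exact_mod_cast hn
    have : (0 : ℝ) < s * Real.log k := lt_of_lt_of_le (by positivity) hs
    exact pos_of_mul_pos_left this (by linarith [hk.log_ge])
  refine (prob_exists_subset_W_le (q := 0.98 * (n / k)) hσ' U s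
    (fun i => by linarith [(hk.card_class_bounds hσ i).1]) (c := 3) (by norm_num)).trans ?_
  have hb := hk.exponent_le hn hd (Nat.le_ceil (d * n / 2))
  have h1 : Real.exp 1 * #U / s ≤ Real.exp (0.75 * Real.log k) := by
    rw [div_le_iff₀ hs0]; linarith
  have h2 : (k : ℝ) * Real.exp (-1.8 * Real.log k) = Real.exp (-0.8 * Real.log k) := by
    nth_rw 1 [← Real.exp_log (show (0 : ℝ) < k by linarith)]
    rw [← Real.exp_add]; congr 1; ring
  calc _ ≤ (Real.exp (0.75 * Real.log k) * (k * Real.exp (-1.8 * Real.log k))) ^ s := by gcongr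
    _ = Real.exp (-0.05 * (s * Real.log k)) := by
        rw [h2, ← Real.exp_add, ← Real.exp_nat_mul]; congr 1; ring
    _ ≤ _ := Real.exp_le_exp.2 (by linarith)

end IsLarge

/-- If one of the three conclusions fails for a set `W`, then `W` contains a set `S` with at most
`δ` vertices of each colour, of prescribed size and lying inside one of few sets `U`. -/
theorem exists_subset_of_violation {n k : ℕ} (σ : Fin n → Fin k) (W : Finset (Fin n))
    {w₁ w₂ w₃ δ x : ℝ} (hx : 0 ≤ x) (hδ : w₂ + 1 ≤ δ) (hw₂ : 0 ≤ w₂) (hw₃ : 0 ≤ w₃)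
    (h : ¬ ((#W : ℝ) ≤ w₁ ∧ (∀ i, (#{v ∈ W | σ v = i} : ℝ) ≤ w₂) ∧
      (#{i | w₃ ≤ (#{v ∈ W | σ v = i} : ℝ)} : ℝ) ≤ x)) :
    ∃ b ∈ insert (univ, ⌈w₁⌉₊) (univ.image (fun i => (univ.filter (fun u => σ u = i), ⌈w₂⌉₊)) ∪
        (powersetCard (⌊x⌋₊ + 1) univ).image fun I => (univ.filter (fun u => σ u ∈ I), ⌈x * w₃⌉₊)),
      ∃ S ⊆ b.1, #S = b.2 ∧ (∀ i, (#{v ∈ S | σ v = i} : ℝ) ≤ δ) ∧ ∀ v ∈ S, v ∈ W := by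
  by_cases h2 : ∀ i, (#{v ∈ W | σ v = i} : ℝ) ≤ w₂
  · have hsmall : ∀ S ⊆ W, ∀ i, (#{v ∈ S | σ v = i} : ℝ) ≤ δ := fun S hS i => by
      have : (#{v ∈ S | σ v = i} : ℝ) ≤ #{v ∈ W | σ v = i} := by
        exact_mod_cast card_le_card (filter_subset_filter _ hS)
      linarith [h2 i]
    by_cases h1 : (#W : ℝ) ≤ w₁
    · have h3 : x < #{i | w₃ ≤ (#{v ∈ W | σ v = i} : ℝ)} := by
        by_contra h3
        exact h ⟨h1, h2, not_lt.1 h3⟩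
      obtain ⟨I, hI, hIc⟩ := exists_subset_card_eq (Nat.succ_le_of_lt ((Nat.floor_lt hx).2 h3))
      have hc : ⌈x * w₃⌉₊ ≤ #{v ∈ W | σ v ∈ I} := by
        rw [Nat.ceil_le, card_eq_sum_card_fiberwise (f := σ) (s := {v ∈ W | σ v ∈ I}) (t := I)
          (fun v hv => (mem_filter.1 (mem_coe.1 hv)).2)]
        push_cast
        calc x * w₃ ≤ ∑ i ∈ I, w₃ := by
              rw [sum_const, nsmul_eq_mul, hIc]
              push_cast
              gcongr
              exact (Nat.lt_floor_add_one x).le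
          _ ≤ _ := sum_le_sum fun i hi => by
              refine (mem_filter.1 (hI hi)).2.trans ?_
              norm_cast
              refine card_le_card fun v hv => ?_
              simp at hv ⊢
              exact ⟨⟨hv.1, hv.2 ▸ hi⟩, hv.2⟩
      obtain ⟨S, hS, hSc⟩ := exists_subset_card_eq hc
      refine ⟨(univ.filter (fun u => σ u ∈ I), ⌈x * w₃⌉₊), ?_, S, fun v hv => ?_, hSc,
        hsmall S (hS.trans (filter_subset _ _)), fun v hv => (mem_filter.1 (hS hv)).1⟩
      · refine mem_insert_of_mem (mem_union_right _ (mem_image_of_mem _ ?_))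
        exact mem_powersetCard.2 ⟨subset_univ _, hIc⟩
      · exact mem_filter.2 ⟨mem_univ _, (mem_filter.1 (hS hv)).2⟩
    · obtain ⟨S, hS, hSc⟩ := exists_subset_card_eq (Nat.ceil_le.2 (not_le.1 h1).le)
      exact ⟨(univ, ⌈w₁⌉₊), mem_insert_self _ _, S, subset_univ _, hSc, hsmall S hS,
        fun v hv => hS hv⟩
  · push Not at h2
    obtain ⟨i, hi⟩ := h2
    obtain ⟨S, hS, hSc⟩ := exists_subset_card_eq (Nat.ceil_le.2 hi.le)
    refine ⟨(univ.filter (fun u => σ u = i), ⌈w₂⌉₊), ?_, S, fun v hv => ?_, hSc, fun j => ?_,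
      fun v hv => (mem_filter.1 (hS hv)).1⟩
    · exact mem_insert_of_mem (mem_union_left _ (mem_image_of_mem _ (mem_univ i)))
    · exact mem_filter.2 ⟨mem_univ _, (mem_filter.1 (hS hv)).2⟩
    · have h1 : (#{v ∈ S | σ v = j} : ℝ) ≤ ⌈w₂⌉₊ := by
        exact_mod_cast (card_le_card (filter_subset _ _)).trans hSc.le
      linarith [Nat.ceil_lt_add_one hw₂]

theorem statement11 :
    ∃ k₀ : ℕ, ∀ k : ℕ, k₀ ≤ k → ∀ d : ℝ,
      2 * k * Real.log k - Real.log k - 4 ≤ d → d ≤ 2 * k * Real.log k →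
      ∃ n₀ : ℕ, ∀ n : ℕ, n₀ ≤ n → ∀ σ : Fin n → Fin k, NearBalanced n k σ →
        1 - Real.exp (-16 * n / k) ≤
          prob (fun e : CondSpace n ⌈d * n / 2⌉₊ k σ =>
            -- (1): `|W| ≤ n·k^(−0.7)`
            ((Nat.card {v : Fin n // ∃ i : Fin k, v ∈ Wset σ e.1 i} : ℝ) ≤
                n * (k : ℝ) ^ (-(0.7 : ℝ))) ∧
            -- (2): `|W_i| ≤ n·ln ln k/(k·ln k)` for all `i`
            (∀ i : Fin k,
              (Nat.card {v : Fin n // v ∈ Wset σ e.1 i} : ℝ) ≤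
                n * Real.log (Real.log k) / (k * Real.log k)) ∧
            -- (3): at most `(ln k)^4` indices `i` with `|W_i| ≥ n/(k·(ln k)^4)`
            ((Nat.card {i : Fin k //
                n / (k * Real.log k ^ (4 : ℕ)) ≤
                  (Nat.card {v : Fin n // v ∈ Wset σ e.1 i} : ℝ)} : ℝ) ≤
              Real.log k ^ (4 : ℕ))) := by
  classical
  obtain ⟨k₀, hk₀⟩ := Filter.eventually_atTop.1 eventually_isLarge
  refine ⟨k₀, fun k hk d hd _ => ⟨k * (1 + k + 2 ^ k), fun n hn σ hσ => ?_⟩⟩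
  have hk := hk₀ k hk
  have hL := hk.log_ge
  have hK := hk.cast_ge
  have hLL := hk.log_log
  have hK0 : (0 : ℝ) < k := by linarith
  have hL0 : 0 < Real.log k := by linarith
  have hnk : (1 + k + 2 ^ k : ℝ) ≤ n / k := by
    rw [le_div_iff₀ hK0, mul_comm]; exact_mod_cast hn
  have hnk0 : (68000 : ℝ) ≤ n / k := by
    have : (0 : ℝ) ≤ 2 ^ k := by positivity
    linarith
  have hn0 : 0 < n := by
    rcases Nat.eq_zero_or_pos n with rfl | h
    · norm_num at hnk0
    · exact h
  have hσ' : ∃ p : Fin n × Fin n, σ p.1 ≠ σ p.2 := by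
    have hne : ∀ i : Fin k, ∃ u, σ u = i := fun i => by
      have h : (0 : ℝ) < #{u | σ u = i} := by linarith [(hk.card_class_bounds hσ i).1]
      obtain ⟨u, hu⟩ := card_pos.1 (Nat.cast_pos.1 h)
      exact ⟨u, (mem_filter.1 hu).2⟩
    have hk2 : 2 ≤ k := by exact_mod_cast (show (2 : ℝ) ≤ k by linarith)
    obtain ⟨u, hu⟩ := hne ⟨0, by omega⟩
    obtain ⟨v, hv⟩ := hne ⟨1, by omega⟩
    exact ⟨(u, v), by simp [hu, hv]⟩
  have : Nonempty (CondSpace n ⌈d * n / 2⌉₊ k σ) := by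
    obtain ⟨p, hp⟩ := hσ'
    exact ⟨⟨fun _ => p, fun _ => hp⟩⟩
  refine le_trans ?_ (one_sub_prob_not_le _)
  set w₁ : ℝ := n * (k : ℝ) ^ (-(0.7 : ℝ)) with hw₁
  set w₂ : ℝ := n * Real.log (Real.log k) / (k * Real.log k) with hw₂
  set w₃ : ℝ := n / (k * Real.log k ^ 4) with hw₃
  set x : ℝ := Real.log k ^ 4 with hx
  set δ : ℝ := 0.01 * (n / k) with hδ
  have hxw₃ : x * w₃ = n / k := by
    have : x ≠ 0 := by positivity
    rw [hw₃]; field_simp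
  have hw₂k : w₂ * Real.log k = n / k * Real.log (Real.log k) := by rw [hw₂]; field_simp
  have hw₂δ : w₂ + 1 ≤ δ := by
    have : w₂ ≤ 0.005 * (n / k) := by
      rw [← mul_le_mul_iff_left₀ hL0, hw₂k]
      nlinarith [hk.log_log_le]
    linarith
  set B : Finset (Finset (Fin n) × ℕ) :=
    insert (univ, ⌈w₁⌉₊) (univ.image (fun i => (univ.filter (fun u => σ u = i), ⌈w₂⌉₊)) ∪
      (powersetCard (⌊x⌋₊ + 1) univ).image fun I =>
        (univ.filter (fun u => σ u ∈ I), ⌈x * w₃⌉₊)) with hB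
  have hBcard : (#B : ℝ) ≤ n / k := by
    refine le_trans ?_ hnk
    have h1 : #B ≤ (k + 2 ^ k) + 1 := by
      refine (card_insert_le _ _).trans (Nat.succ_le_succ ((card_union_le _ _).trans ?_))
      refine add_le_add (card_image_le.trans (by simp)) (card_image_le.trans ?_)
      refine (card_le_card (subset_univ _)).trans ?_
      simp
    have h2 : (#B : ℝ) ≤ (k + 2 ^ k) + 1 := by exact_mod_cast h1
    linarith
  have hB' : ∀ b ∈ B, Real.exp 1 * #b.1 ≤ b.2 * Real.exp (0.75 * Real.log k) ∧
      340 * (n / k : ℝ) ≤ b.2 * Real.log k := by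
    intro b hb
    simp only [hB, mem_insert, mem_union, mem_image] at hb
    have hpow : Real.exp 1 * (2 * (x + 1)) ≤ Real.exp (0.75 * Real.log k) := by
      linarith [hk.log_pow]
    rcases hb with rfl | ⟨i, -, rfl⟩ | ⟨I, hI, rfl⟩
    · have hk7 : (k : ℝ) ^ (-(0.7 : ℝ)) = Real.exp (-0.7 * Real.log k) := by
        rw [Real.rpow_def_of_pos hK0]; congr 1; ring
      simp only [card_univ, Fintype.card_fin]
      constructor
      · calc Real.exp 1 * n ≤ Real.exp (-0.7 * Real.log k + 0.75 * Real.log k) * n := by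
              gcongr; linarith
          _ = w₁ * Real.exp (0.75 * Real.log k) := by rw [hw₁, hk7, Real.exp_add]; ring
          _ ≤ _ := by gcongr; exact Nat.le_ceil _
      · have h1 : (n / k : ℝ) ≤ w₁ := by
          rw [hw₁, hk7, div_eq_mul_inv]
          gcongr
          nth_rw 1 [← Real.exp_log hK0]
          rw [← Real.exp_neg]
          gcongr
          linarith
        calc 340 * (n / k : ℝ) ≤ w₁ * Real.log k := by nlinarith
          _ ≤ _ := by gcongr; exact Nat.le_ceil _
    · constructor
      · have h1 : Real.exp 1 * (2 * Real.log k) ≤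
            Real.exp (0.75 * Real.log k) * Real.log (Real.log k) := by
          have : Real.log k ≤ x := le_self_pow₀ (by linarith) (by norm_num)
          calc Real.exp 1 * (2 * Real.log k) ≤ Real.exp 1 * (2 * (x + 1)) := by
                gcongr; linarith
            _ ≤ Real.exp (0.75 * Real.log k) * 1 := by linarith
            _ ≤ _ := by gcongr; linarith
        calc Real.exp 1 * (#{u | σ u = i} : ℝ) ≤ Real.exp 1 * (2 * (n / k)) := by
              gcongr; exact (hk.card_class_bounds hσ i).2
          _ ≤ w₂ * Real.exp (0.75 * Real.log k) := by
              rw [← mul_le_mul_iff_left₀ hL0]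
              calc _ = n / k * (Real.exp 1 * (2 * Real.log k)) := by ring
                _ ≤ n / k * (Real.exp (0.75 * Real.log k) * Real.log (Real.log k)) := by gcongr
                _ = (w₂ * Real.log k) * Real.exp (0.75 * Real.log k) := by rw [hw₂k]; ring
                _ = _ := by ring
          _ ≤ _ := by gcongr; exact Nat.le_ceil _
      · calc 340 * (n / k : ℝ) ≤ w₂ * Real.log k := by rw [hw₂k]; nlinarith
          _ ≤ _ := by gcongr; exact Nat.le_ceil _
    · have hs : (n / k : ℝ) ≤ ⌈x * w₃⌉₊ := by
        rw [hxw₃]; exact Nat.le_ceil _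
      constructor
      · have hcard : (#{u | σ u ∈ I} : ℝ) ≤ (x + 1) * (2 * (n / k)) := by
          rw [card_eq_sum_card_fiberwise (f := σ) (s := {u | σ u ∈ I}) (t := I)
            (fun v hv => by simpa using hv)]
          push_cast
          calc _ ≤ ∑ i ∈ I, (2 * (n / k) : ℝ) := sum_le_sum fun i _ => by
                refine le_trans ?_ (hk.card_class_bounds hσ i).2
                norm_cast
                refine card_le_card fun v hv => ?_
                simp at hv ⊢
                exact hv.2
            _ ≤ _ := by
                rw [sum_const, nsmul_eq_mul, (mem_powersetCard.1 hI).2]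
                push_cast
                gcongr
                exact Nat.floor_le (by positivity)
        calc Real.exp 1 * (#{u | σ u ∈ I} : ℝ) ≤ Real.exp 1 * ((x + 1) * (2 * (n / k))) := by gcongr
          _ = n / k * (Real.exp 1 * (2 * (x + 1))) := by ring
          _ ≤ _ := by gcongr
      · calc 340 * (n / k : ℝ) ≤ n / k * Real.log k := by nlinarith
          _ ≤ _ := by gcongr
  rw [sub_le_sub_iff_left]
  calc _ ≤ ∑ b ∈ B, prob (fun e : CondSpace n ⌈d * n / 2⌉₊ k σ => ∃ S ⊆ b.1, #S = b.2 ∧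
        (∀ i, (#{u ∈ S | σ u = i} : ℝ) ≤ δ) ∧ ∀ v ∈ S, v ∈ Wset σ e.1 (σ v)) := by
        refine prob_le_sum B _ fun e he => ?_
        have hWi : ∀ i, Nat.card {v : Fin n // v ∈ Wset σ e.1 i} =
            #{v ∈ univ.filter (fun v => v ∈ Wset σ e.1 (σ v)) | σ v = i} := fun i => by
          rw [Nat.card_eq_fintype_card, Fintype.card_subtype, filter_filter]
          congr 1
          ext v
          simp only [mem_filter, mem_univ, true_and]
          rw [mem_Wset_iff, and_comm]
        have hW : Nat.card {v : Fin n // ∃ i : Fin k, v ∈ Wset σ e.1 i} =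
            #(univ.filter (fun v => v ∈ Wset σ e.1 (σ v))) := by
          rw [Nat.card_eq_fintype_card, Fintype.card_subtype]
          congr 1
          ext v
          simp only [mem_filter, mem_univ, true_and]
          exact ⟨fun ⟨i, hi⟩ => (mem_Wset_iff.1 hi).2, fun h => ⟨_, h⟩⟩
        simp only [hW, hWi] at he
        rw [Nat.card_eq_fintype_card, Fintype.card_subtype] at he
        obtain ⟨b, hb, S, hS⟩ := exists_subset_of_violation σ _ (by positivity) hw₂δ
          (by positivity) (by positivity) he
        exact ⟨b, hb, S, by simpa using hS⟩
    _ ≤ ∑ b ∈ B, Real.exp (-17 * (n / k)) := sum_le_sum fun b hb =>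
        hk.prob_exists_subset_W_le_exp hn0 hd hσ hσ' b.1 b.2 (hB' b hb).1 (hB' b hb).2
    _ ≤ Real.exp (n / k) * Real.exp (-17 * (n / k)) := by
        rw [sum_const, nsmul_eq_mul]
        gcongr
        linarith [Real.add_one_le_exp (n / k : ℝ)]
    _ = _ := by rw [← Real.exp_add]; congr 1; ring
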